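/- Assume additionally that P is supported in { σ ∈ ℝ^N : |σ|² ≤ N }. Then for any two parameter vectors q = (q_0,…,q_k) and q' = (q'_0,…,q'_k) with 0 < q_0 < q_1 < ⋯ < q_k and 0 < q'_0 < q'_1 < ⋯ < q'_k, one has | F(q'_0,…,q'_k) − F(q_0,…,q_k) | ≤ ∑_{ℓ=0}^k (ζ_{ℓ+1} − ζ_ℓ) | q'_ℓ − q_ℓ |. -/

import Mathlib

open MeasureTheory ProbabilityTheory

/-- Standard Gaussian measure on `ℝ^N`. -/
noncomputable def gaussN (N : ℕ) : Measure (Fin N → ℝ) :=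
  Measure.pi fun _ => gaussianReal 0 1

/-- The innermost quantity
`X_k(y_0,…,y_k) = log ∫ exp(G(σ) + ∑_ℓ (2q_ℓ - 2q_{ℓ-1})^{1/2} y_ℓ·σ - q_k|σ|²) dP(σ)`,
with the convention `q_{-1} = 0`. -/
noncomputable def Xtop (N k : ℕ) (q : ℕ → ℝ) (P : Measure (Fin N → ℝ))
    (G : (Fin N → ℝ) → ℝ) (y : ℕ → Fin N → ℝ) : ℝ :=
  Real.log (∫ σ, Real.exp (G σ
    + (∑ ℓ ∈ Finset.range (k + 1),
        Real.sqrt (2 * q ℓ - 2 * (if ℓ = 0 then 0 else q (ℓ - 1))) * ∑ i, y ℓ i * σ i)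
    - q k * ∑ i, σ i ^ 2) ∂P)

/-- The downward recursion `X_{ℓ-1} = ζ_ℓ⁻¹ log E_{y_ℓ} exp(ζ_ℓ X_ℓ)`, reindexed so that
`cascade j = X_{k-j}`; in particular `cascade 0 = X_k` and `cascade k = X_0`. -/
noncomputable def cascade (N k : ℕ) (ζ q : ℕ → ℝ) (P : Measure (Fin N → ℝ))
    (G : (Fin N → ℝ) → ℝ) : ℕ → (ℕ → Fin N → ℝ) → ℝ
  | 0 => Xtop N k q P G
  | j + 1 => fun y => (ζ (k - j))⁻¹ *
      Real.log (∫ z, Real.exp (ζ (k - j) *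
        cascade N k ζ q P G j (Function.update y (k - j) z)) ∂(gaussN N))

/-- The free energy `F(q_0,…,q_k) = -N⁻¹ E_{y_0}[X_0(y_0)]`. -/
noncomputable def freeEnergyQ (N k : ℕ) (ζ : ℕ → ℝ) (P : Measure (Fin N → ℝ))
    (G : (Fin N → ℝ) → ℝ) (q : ℕ → ℝ) : ℝ :=
  -(1 / (N : ℝ)) * ∫ z, cascade N k ζ q P G k (fun _ => z) ∂(gaussN N)

instance gaussN_isProbabilityMeasure (N : ℕ) : IsProbabilityMeasure (gaussN N) := by
  unfold gaussN; infer_instance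

theorem integrable_exp_sum_abs_gaussN (N : ℕ) (c : ℝ) :
    Integrable (fun z : Fin N → ℝ => Real.exp (c * ∑ i, |z i|)) (gaussN N) := by
  have h1 : Integrable (fun t : ℝ => Real.exp (c * |t|)) (gaussianReal 0 1) :=
    integrable_exp_mul_abs (integrable_exp_mul_gaussianReal c) (integrable_exp_mul_gaussianReal (-c))
  have h2 := Integrable.fintype_prod (ι := Fin N) (f := fun _ t => Real.exp (c * |t|))
    (μ := fun _ => gaussianReal 0 1) (fun _ => h1)
  simpa only [gaussN, Finset.mul_sum, Real.exp_sum] using h2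

theorem norm_le_sum_abs {N : ℕ} (z : Fin N → ℝ) : ‖z‖ ≤ ∑ i, |z i| :=
  (pi_norm_le_iff_of_nonneg (Finset.sum_nonneg fun _ _ => abs_nonneg _)).2 fun i =>
    Finset.single_le_sum (f := fun i => |z i|) (fun _ _ => abs_nonneg _) (Finset.mem_univ i)

theorem LipschitzWith.abs_add_sub_le {N : ℕ} {K : NNReal} {h : (Fin N → ℝ) → ℝ}
    (hh : LipschitzWith K h) (x v : Fin N → ℝ) : |h (x + v) - h x| ≤ K * ‖v‖ := by
  simpa [Real.dist_eq, dist_eq_norm] using hh.dist_le_mul (x + v) x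

theorem LipschitzWith.integrable_exp_gaussN {N : ℕ} {K : NNReal} {h : (Fin N → ℝ) → ℝ}
    (hh : LipschitzWith K h) (c : ℝ) :
    Integrable (fun z => Real.exp (c * h z)) (gaussN N) := by
  refine ((integrable_exp_sum_abs_gaussN N (|c| * K)).const_mul (Real.exp (|c| * |h 0|))).mono'
    (by have := hh.continuous; fun_prop) (ae_of_all _ fun z => ?_)
  rw [Real.norm_eq_abs, Real.abs_exp, ← Real.exp_add]
  gcongr
  have h1 := hh.abs_add_sub_le 0 z
  rw [zero_add] at h1
  have h2 : |h z| ≤ |h 0| + K * ∑ i, |z i| := by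
    have h3 : (K : ℝ) * ‖z‖ ≤ K * ∑ i, |z i| := by gcongr; exact norm_le_sum_abs z
    have := abs_sub_abs_le_abs_sub (h z) (h 0)
    linarith
  calc c * h z ≤ |c| * |h z| := (le_abs_self _).trans (abs_mul _ _).le
    _ ≤ |c| * (|h 0| + K * ∑ i, |z i|) := by gcongr
    _ = _ := by ring

theorem integrable_of_exp_gaussN {N : ℕ} {h : (Fin N → ℝ) → ℝ} (hm : Continuous h) {c : ℝ}
    (hc : ∀ z, |h z| ≤ Real.exp (c * ∑ i, |z i|)) : Integrable h (gaussN N) :=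
  (integrable_exp_sum_abs_gaussN N c).mono' hm.aestronglyMeasurable
    (ae_of_all _ fun z => by simpa using hc z)

theorem LipschitzWith.integrable_gaussN {N : ℕ} {K : NNReal} {h : (Fin N → ℝ) → ℝ}
    (hh : LipschitzWith K h) : Integrable h (gaussN N) := by
  refine ((hh.integrable_exp_gaussN 1).add (hh.integrable_exp_gaussN (-1))).mono'
    hh.continuous.aestronglyMeasurable (ae_of_all _ fun z => ?_)
  have h1 := Real.add_one_le_exp (1 * h z)
  have h2 := Real.add_one_le_exp (-1 * h z)
  have h3 := Real.exp_pos (1 * h z)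
  have h4 := Real.exp_pos (-1 * h z)
  simp only [Pi.add_apply, Real.norm_eq_abs]
  rcases abs_cases (h z) with h | h <;> linarith

theorem gaussN_map_add (N : ℕ) {α β ρ : ℝ} (h : α ^ 2 + β ^ 2 = ρ ^ 2) :
    ((gaussN N).prod (gaussN N)).map (fun p => α • p.1 + β • p.2)
      = (gaussN N).map (fun z => ρ • z) := by
  have h1 : ((gaussianReal 0 1).prod (gaussianReal 0 1)).map (fun p : ℝ × ℝ => α * p.1 + β * p.2)
      = (gaussianReal 0 1).map (fun t => ρ * t) := by
    have : (fun p : ℝ × ℝ => α * p.1 + β * p.2)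
        = (fun p : ℝ × ℝ => p.1 + p.2) ∘ Prod.map (fun t => α * t) (fun t => β * t) := rfl
    rw [this, ← Measure.map_map (by fun_prop) (by fun_prop), ← Measure.map_prod_map _ _ (by fun_prop)
      (by fun_prop), gaussianReal_map_const_mul, gaussianReal_map_const_mul,
      gaussianReal_map_const_mul]
    change Measure.conv _ _ = _
    rw [gaussianReal_conv_gaussianReal]
    congr 1
    · simp
    · ext; simpa using h
  have he := (measurePreserving_arrowProdEquivProdArrow ℝ ℝ (Fin N)
    (fun _ => gaussianReal 0 1) (fun _ => gaussianReal 0 1)).map_eq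
  unfold gaussN
  rw [← he, Measure.map_map (by fun_prop) (MeasurableEquiv.measurable _)]
  have h2 := Measure.pi_map_pi (μ := fun _ : Fin N => (gaussianReal 0 1).prod (gaussianReal 0 1))
    (f := fun _ (p : ℝ × ℝ) => α * p.1 + β * p.2) (fun _ => by fun_prop)
  have h3 := Measure.pi_map_pi (μ := fun _ : Fin N => gaussianReal 0 1)
    (f := fun _ (t : ℝ) => ρ * t) (fun _ => by fun_prop)
  refine Eq.trans ?_ (h2.trans (Eq.trans ?_ h3.symm))
  · rfl
  · simp only [h1]

theorem integral_exp_dotProduct_gaussN {N : ℕ} (σ : Fin N → ℝ) (c : ℝ) :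
    ∫ z, Real.exp (c * z ⬝ᵥ σ) ∂(gaussN N) = Real.exp (c ^ 2 / 2 * σ ⬝ᵥ σ) := by
  have h1 : ∫ z : Fin N → ℝ, ∏ i, Real.exp (c * σ i * z i) ∂(gaussN N)
      = ∏ i, Real.exp ((c * σ i) ^ 2 / 2) := by
    rw [gaussN, integral_fintype_prod_eq_prod (fun i t => Real.exp (c * σ i * t))]
    refine Finset.prod_congr rfl fun i _ => ?_
    have := mgf_gaussianReal (p := gaussianReal 0 1) (X := id) (μ := 0) (v := 1) (by simp) (c * σ i)
    simpa [mgf] using this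
  rw [← Real.exp_sum] at h1
  convert h1 using 2
  · ext z
    rw [dotProduct, Finset.mul_sum, Real.exp_sum]
    exact Finset.prod_congr rfl fun i _ => by ring_nf
  · rw [dotProduct, Finset.mul_sum]
    exact Finset.sum_congr rfl fun i _ => by ring

theorem integral_dotProduct_sq_gaussN {N : ℕ} (p : Fin N → ℝ) :
    ∫ z, (p ⬝ᵥ z) ^ 2 ∂(gaussN N) = p ⬝ᵥ p := by
  have hL : ∀ i, MemLp (fun t => p i * t) 2 (gaussianReal 0 1) := fun i =>
    (memLp_id_gaussianReal 2).const_mul _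
  have h1 := variance_sum_pi (μ := fun _ : Fin N => gaussianReal 0 1) (X := fun i t => p i * t) hL
  have h0 : ∫ z, (∑ i, fun z : Fin N → ℝ => p i * z i) z ∂(gaussN N) = 0 := by
    simp only [Finset.sum_apply]
    rw [integral_finsetSum _ fun i _ => ?_]
    · refine Finset.sum_eq_zero fun i _ => ?_
      rw [integral_const_mul]
      have : ∫ z : Fin N → ℝ, z i ∂(gaussN N) = ∫ t, t ∂(gaussianReal 0 1) :=
        integral_comp_eval (μ := fun _ : Fin N => gaussianReal 0 1) (f := fun t : ℝ => t)
          (by fun_prop)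
      rw [this, integral_id_gaussianReal, mul_zero]
    · exact ((hL i).comp_measurePreserving (measurePreserving_eval _ i)).integrable one_le_two
  rw [← gaussN, variance_of_integral_eq_zero _ h0] at h1
  · have hv : ∀ i, Var[fun t => p i * t; gaussianReal 0 1] = p i * p i := fun i => by
      rw [variance_const_mul, variance_fun_id_gaussianReal]; simp [pow_two]
    simpa [dotProduct, hv] using h1
  · fun_prop

/-- The operator `g ↦ a⁻¹ log E exp (a g(x + √(2s) z))` with `z` standard Gaussian, read as
`E g(x + √(2s) z)` when `a = 0`. -/
noncomputable def parisiStep {N : ℕ} (a s : ℝ) (g : (Fin N → ℝ) → ℝ) (x : Fin N → ℝ) : ℝ :=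
  if a = 0 then ∫ z, g (x + √(2 * s) • z) ∂(gaussN N)
  else a⁻¹ * Real.log (∫ z, Real.exp (a * g (x + √(2 * s) • z)) ∂(gaussN N))

section ParisiStep

variable {N : ℕ} {K K' : NNReal} {g h : (Fin N → ℝ) → ℝ}

theorem LipschitzWith.comp_add_smul (hg : LipschitzWith K g) (x : Fin N → ℝ) (c : ℝ) :
    LipschitzWith (K * ‖c‖₊) (fun z => g (x + c • z)) := by
  refine hg.comp (LipschitzWith.of_dist_le_mul fun y z => ?_)
  simp [dist_eq_norm, ← smul_sub, norm_smul]

theorem LipschitzWith.comp_add_left (hg : LipschitzWith K g) (v : Fin N → ℝ) :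
    LipschitzWith K (fun x => g (x + v)) :=
  LipschitzWith.of_dist_le_mul fun y z => by simpa using hg.dist_le_mul (y + v) (z + v)

theorem LipschitzWith.integral_exp_gaussN_pos (hg : LipschitzWith K g) (a c : ℝ) (x : Fin N → ℝ) :
    0 < ∫ z, Real.exp (a * g (x + c • z)) ∂(gaussN N) :=
  integral_exp_pos ((hg.comp_add_smul x c).integrable_exp_gaussN a)

theorem exp_mul_parisiStep (hg : LipschitzWith K g) {a : ℝ} (ha : a ≠ 0) (s : ℝ) (x : Fin N → ℝ) :
    Real.exp (a * parisiStep a s g x)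
      = ∫ z, Real.exp (a * g (x + √(2 * s) • z)) ∂(gaussN N) := by
  rw [parisiStep, if_neg ha, mul_inv_cancel_left₀ ha, Real.exp_log (hg.integral_exp_gaussN_pos _ _ _)]

theorem parisiStep_le_add (hg : LipschitzWith K g) (hh : LipschitzWith K' h) {a : ℝ} (ha : 0 ≤ a)
    (s : ℝ) {c : ℝ} (hgh : ∀ x, g x ≤ h x + c) (x : Fin N → ℝ) :
    parisiStep a s g x ≤ parisiStep a s h x + c := by
  rcases ha.eq_or_lt with rfl | ha
  · simp only [parisiStep, if_true]
    have hi := (hh.comp_add_smul x √(2 * s)).integrable_gaussN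
    calc _ ≤ ∫ z, (h (x + √(2 * s) • z) + c) ∂(gaussN N) :=
          integral_mono (hg.comp_add_smul x _).integrable_gaussN (hi.add (integrable_const c))
            fun z => hgh _
      _ = _ := by rw [integral_add hi (integrable_const c)]; simp
  · rw [← mul_le_mul_iff_of_pos_left ha, ← Real.exp_le_exp, mul_add, Real.exp_add,
      exp_mul_parisiStep hg ha.ne', exp_mul_parisiStep hh ha.ne', ← integral_mul_const]
    refine integral_mono ((hg.comp_add_smul x _).integrable_exp_gaussN a)
      (((hh.comp_add_smul x _).integrable_exp_gaussN a).mul_const _) fun z => ?_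
    simp only [← Real.exp_add, ← mul_add]
    gcongr
    exact hgh _

theorem parisiStep_comp_add (a s : ℝ) (g : (Fin N → ℝ) → ℝ) (x v : Fin N → ℝ) :
    parisiStep a s (fun y => g (y + v)) x = parisiStep a s g (x + v) := by
  simp only [parisiStep, add_right_comm]

theorem LipschitzWith.parisiStep (hg : LipschitzWith K g) {a : ℝ} (ha : 0 ≤ a) (s : ℝ) :
    LipschitzWith K (parisiStep a s g) := by
  refine LipschitzWith.of_le_add_mul K fun x y => ?_
  have h1 := parisiStep_le_add (hg.comp_add_left (x - y)) hg ha s (c := K * ‖x - y‖)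
    (fun z => by linarith [(abs_le.1 (hg.abs_add_sub_le z (x - y))).2]) y
  rwa [parisiStep_comp_add, add_sub_cancel, ← dist_eq_norm] at h1

theorem parisiStep_zero_right (a : ℝ) (g : (Fin N → ℝ) → ℝ) : parisiStep a 0 g = g := by
  ext x
  by_cases ha : a = 0
  · simp [parisiStep, ha]
  · simp [parisiStep, ha]

theorem integral_integral_gaussN_add {F : (Fin N → ℝ) → ℝ} (hF : Continuous F) {α β ρ : ℝ}
    (h : α ^ 2 + β ^ 2 = ρ ^ 2) (hi : Integrable (fun z => F (ρ • z)) (gaussN N)) :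
    ∫ y, ∫ z, F (α • y + β • z) ∂(gaussN N) ∂(gaussN N) = ∫ z, F (ρ • z) ∂(gaussN N) := by
  have hm := gaussN_map_add N h
  have hi' : Integrable F ((gaussN N).map (fun z => ρ • z)) :=
    (integrable_map_measure hF.aestronglyMeasurable (by fun_prop)).2 hi
  rw [← integral_map (f := F) (φ := fun z => ρ • z) (by fun_prop) hF.aestronglyMeasurable, ← hm,
    integral_map (by fun_prop) hF.aestronglyMeasurable, integral_prod]
  rw [← hm] at hi'
  exact (integrable_map_measure hF.aestronglyMeasurable (by fun_prop)).1 hi'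

/-- The semigroup property at a fixed exponent. -/
theorem parisiStep_parisiStep (hg : LipschitzWith K g) {a s t : ℝ} (ha : 0 ≤ a) (hs : 0 ≤ s)
    (ht : 0 ≤ t) : parisiStep a s (parisiStep a t g) = parisiStep a (s + t) g := by
  ext x
  have hρ : √(2 * s) ^ 2 + √(2 * t) ^ 2 = √(2 * (s + t)) ^ 2 := by
    rw [Real.sq_sqrt, Real.sq_sqrt, Real.sq_sqrt] <;> linarith
  have hc := hg.continuous
  rcases ha.eq_or_lt with rfl | ha'
  · simp only [parisiStep, if_true, add_assoc]
    exact integral_integral_gaussN_add (F := fun y => g (x + y)) (by fun_prop) hρ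
      (hg.comp_add_smul x _).integrable_gaussN
  · have h1 := exp_mul_parisiStep (hg.parisiStep ha t) ha'.ne' s x
    have h2 := exp_mul_parisiStep hg ha'.ne' (s + t) x
    simp only [exp_mul_parisiStep hg ha'.ne', add_assoc] at h1
    rw [integral_integral_gaussN_add (F := fun y => Real.exp (a * g (x + y))) (by fun_prop) hρ
      ((hg.comp_add_smul x _).integrable_exp_gaussN a), ← h2] at h1
    exact mul_left_cancel₀ ha'.ne' (Real.exp_injective h1)

theorem integral_const_add_mul {Ω : Type*} [MeasurableSpace Ω] {μ : Measure Ω}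
    [IsProbabilityMeasure μ] {f : Ω → ℝ} (hf : Integrable f μ) (A B : ℝ) :
    ∫ ω, (A + B * f ω) ∂μ = A + B * ∫ ω, f ω ∂μ := by
  rw [integral_add (integrable_const _) (hf.const_mul _), integral_const_mul]
  simp

theorem parisiStep_mono_left (hg : LipschitzWith K g) {a b : ℝ} (ha : 0 ≤ a) (hab : a ≤ b)
    (s : ℝ) (x : Fin N → ℝ) : parisiStep a s g x ≤ parisiStep b s g x := by
  rcases hab.eq_or_lt with rfl | hab
  · rfl
  have hb : 0 < b := ha.trans_lt hab
  set c := parisiStep a s g x with hc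
  set f : (Fin N → ℝ) → ℝ := fun z => g (x + √(2 * s) • z) with hf
  have hfL : LipschitzWith _ f := hg.comp_add_smul x _
  rw [← mul_le_mul_iff_of_pos_left hb, ← Real.exp_le_exp, exp_mul_parisiStep hg hb.ne']
  rcases ha.eq_or_lt with rfl | ha
  · have hi := hfL.integrable_gaussN
    have hc' : c = ∫ z, f z ∂(gaussN N) := by simp [hc, parisiStep, hf]
    calc Real.exp (b * c)
        = Real.exp (b * c) * (1 - b * c) + Real.exp (b * c) * b * ∫ z, f z ∂(gaussN N) := by
          rw [← hc']; ring
      _ = ∫ z, (Real.exp (b * c) * (1 - b * c) + Real.exp (b * c) * b * f z) ∂(gaussN N) :=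
          (integral_const_add_mul hi _ _).symm
      _ ≤ ∫ z, Real.exp (b * f z) ∂(gaussN N) := by
          refine integral_mono ((integrable_const _).add (hi.const_mul _))
            (hfL.integrable_exp_gaussN b) fun z => ?_
          have := Real.add_one_le_exp (b * (f z - c))
          calc _ = Real.exp (b * c) * (b * (f z - c) + 1) := by ring
            _ ≤ Real.exp (b * c) * Real.exp (b * (f z - c)) := by gcongr
            _ = _ := by rw [← Real.exp_add]; ring_nf
  · have hE : Real.exp (a * c) = ∫ z, Real.exp (a * f z) ∂(gaussN N) :=
      exp_mul_parisiStep hg ha.ne' s x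
    have hi := hfL.integrable_exp_gaussN a
    set B := Real.exp (b * c) * (b / a) with hB
    calc Real.exp (b * c)
        = (Real.exp (b * c) - B) + B * Real.exp (-(a * c)) * ∫ z, Real.exp (a * f z) ∂(gaussN N) := by
          rw [← hE, mul_assoc, ← Real.exp_add]; simp
      _ = ∫ z, ((Real.exp (b * c) - B) + B * Real.exp (-(a * c)) * Real.exp (a * f z)) ∂(gaussN N) :=
          (integral_const_add_mul hi _ _).symm
      _ ≤ ∫ z, Real.exp (b * f z) ∂(gaussN N) := by
          refine integral_mono ((integrable_const _).add (hi.const_mul _))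
            (hfL.integrable_exp_gaussN b) fun z => ?_
          have hBer := one_add_mul_self_le_rpow_one_add
            (s := Real.exp (a * (f z - c)) - 1) (by linarith [Real.exp_pos (a * (f z - c))])
            (p := b / a) ((one_le_div ha).2 hab.le)
          rw [add_sub_cancel, ← Real.exp_mul] at hBer
          calc _ = Real.exp (b * c) * (1 + b / a * (Real.exp (a * (f z - c)) - 1)) := by
                rw [mul_assoc B, ← Real.exp_add, hB]; ring_nf
            _ ≤ Real.exp (b * c) * Real.exp (a * (f z - c) * (b / a)) := by gcongr
            _ = _ := by
                rw [← Real.exp_add]; congr 1; field_simp; ring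

end ParisiStep

/-- `g` has a measurable gradient `p` of squared Euclidean norm at most `L`, with a quadratic
error of constant `M` in its first order expansions. -/
def HasBoundedExpansion {N : ℕ} (L M : ℝ) (g : (Fin N → ℝ) → ℝ) : Prop :=
  ∃ p : (Fin N → ℝ) → Fin N → ℝ, Measurable p ∧ (∀ x, p x ⬝ᵥ p x ≤ L) ∧
    ∀ x v, |g (x + v) - g x - p x ⬝ᵥ v| ≤ M * v ⬝ᵥ v

theorem dotProduct_sq_le {N : ℕ} (p v : Fin N → ℝ) : (p ⬝ᵥ v) ^ 2 ≤ (p ⬝ᵥ p) * (v ⬝ᵥ v) := by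
  simpa [dotProduct, pow_two] using Finset.sum_mul_sq_le_sq_mul_sq Finset.univ p v

theorem abs_apply_le_sqrt {N : ℕ} {L : ℝ} {p : Fin N → ℝ} (h : p ⬝ᵥ p ≤ L) (i : Fin N) :
    |p i| ≤ √L := by
  refine Real.abs_le_sqrt (le_trans ?_ h)
  rw [pow_two]
  exact Finset.single_le_sum (f := fun i => p i * p i) (fun i _ => mul_self_nonneg _)
    (Finset.mem_univ i)

section Mean

variable {N : ℕ} {Ω : Type*} [MeasurableSpace Ω] {ν : Measure Ω} [IsProbabilityMeasure ν]
  {p : Ω → Fin N → ℝ} {L M : ℝ}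

theorem integrable_apply_of_dotProduct_le (hp : Measurable p) (hL : ∀ᵐ ω ∂ν, p ω ⬝ᵥ p ω ≤ L)
    (i : Fin N) : Integrable (fun ω => p ω i) ν :=
  Integrable.of_bound (by fun_prop) √L (hL.mono fun _ hω => abs_apply_le_sqrt hω i)

theorem integrable_dotProduct_of_le (hp : Measurable p) (hL : ∀ᵐ ω ∂ν, p ω ⬝ᵥ p ω ≤ L)
    (v : Fin N → ℝ) : Integrable (fun ω => p ω ⬝ᵥ v) ν :=
  integrable_finsetSum _ fun i _ => (integrable_apply_of_dotProduct_le hp hL i).mul_const _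

theorem mean_dotProduct (hp : Measurable p) (hL : ∀ᵐ ω ∂ν, p ω ⬝ᵥ p ω ≤ L) (v : Fin N → ℝ) :
    (fun i => ∫ ω, p ω i ∂ν) ⬝ᵥ v = ∫ ω, p ω ⬝ᵥ v ∂ν := by
  simp only [dotProduct]
  rw [integral_finsetSum _ fun i _ => (integrable_apply_of_dotProduct_le hp hL i).mul_const _]
  simp only [integral_mul_const]

theorem mean_dotProduct_self_le (hp : Measurable p) (hL : ∀ᵐ ω ∂ν, p ω ⬝ᵥ p ω ≤ L) :
    (fun i => ∫ ω, p ω i ∂ν) ⬝ᵥ (fun i => ∫ ω, p ω i ∂ν) ≤ L := by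
  set m : Fin N → ℝ := fun i => ∫ ω, p ω i ∂ν with hm
  have h1 : m ⬝ᵥ m ≤ ∫ _, (L + m ⬝ᵥ m) / 2 ∂ν := by
    rw [show m ⬝ᵥ m = ∫ ω, p ω ⬝ᵥ m ∂ν from mean_dotProduct hp hL m]
    refine integral_mono_ae (integrable_dotProduct_of_le hp hL m) (integrable_const _)
      (hL.mono fun ω hω => ?_)
    have h2 : 0 ≤ (p ω - m) ⬝ᵥ (p ω - m) :=
      Finset.sum_nonneg fun i _ => mul_self_nonneg _
    simp only [sub_dotProduct, dotProduct_sub, dotProduct_comm m (p ω)] at h2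
    have h3 := mean_dotProduct hp hL m
    rw [← hm] at h3
    simp only [← h3]
    linarith
  simp only [integral_const, probReal_univ, smul_eq_mul, one_mul] at h1
  linarith

theorem abs_inv_mul_log_integral_exp_sub_le (hp : Measurable p)
    (hL : ∀ᵐ ω ∂ν, p ω ⬝ᵥ p ω ≤ L) {A : Ω → ℝ} (hA : AEStronglyMeasurable A ν) {v : Fin N → ℝ}
    (hM : ∀ᵐ ω ∂ν, |A ω - p ω ⬝ᵥ v| ≤ M * v ⬝ᵥ v) {a : ℝ} (ha : 0 < a) :
    |a⁻¹ * Real.log (∫ ω, Real.exp (a * A ω) ∂ν) - (fun i => ∫ ω, p ω i ∂ν) ⬝ᵥ v|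
      ≤ (M + a * L / 2) * v ⬝ᵥ v := by
  have hv : 0 ≤ v ⬝ᵥ v := Finset.sum_nonneg fun i _ => mul_self_nonneg _
  have hL0 : 0 ≤ L := by
    obtain ⟨ω, hω⟩ := hL.exists
    exact le_trans (Finset.sum_nonneg fun i _ => mul_self_nonneg _) hω
  set R := √(L * v ⬝ᵥ v) with hR
  set c := ∫ ω, p ω ⬝ᵥ v ∂ν with hc
  rw [mean_dotProduct hp hL v, ← hc]
  have hX : ∀ᵐ ω ∂ν, |p ω ⬝ᵥ v| ≤ R := hL.mono fun ω hω =>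
    Real.abs_le_sqrt ((dotProduct_sq_le _ _).trans (by gcongr))
  have hXm : Measurable fun ω => p ω ⬝ᵥ v := by unfold dotProduct; fun_prop
  have hXi := integrable_dotProduct_of_le hp hL v
  have hsub := (hasSubgaussianMGF_of_mem_Icc (a := -R) (b := R) hXm.aemeasurable
    (hX.mono fun ω hω => abs_le.1 hω)).mgf_le a
  have hsubi := (hasSubgaussianMGF_of_mem_Icc (a := -R) (b := R) hXm.aemeasurable
    (hX.mono fun ω hω => abs_le.1 hω)).integrable_exp_mul a
  rw [← hc] at hsub hsubi
  have hexp : Integrable (fun ω => Real.exp (a * A ω)) ν := by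
    refine Integrable.of_bound (by fun_prop) (Real.exp (a * (M * v ⬝ᵥ v + R))) ?_
    filter_upwards [hX, hM] with ω h1 h2
    rw [Real.norm_eq_abs, Real.abs_exp]
    gcongr
    linarith [(abs_le.1 h1).2, (abs_le.1 h2).2]
  have hup : ∫ ω, Real.exp (a * A ω) ∂ν
      ≤ Real.exp (a * (c + (M + a * L / 2) * v ⬝ᵥ v)) := by
    calc _ ≤ ∫ ω, Real.exp (a * (M * v ⬝ᵥ v + c)) * Real.exp (a * (p ω ⬝ᵥ v - c)) ∂ν := by
          refine integral_mono_ae hexp (hsubi.const_mul _) (hM.mono fun ω hω => ?_)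
          simp only [← Real.exp_add, ← mul_add]
          gcongr
          linarith [(abs_le.1 hω).2]
      _ ≤ Real.exp (a * (M * v ⬝ᵥ v + c)) * Real.exp (R ^ 2 * a ^ 2 / 2) := by
          rw [integral_const_mul]
          gcongr
          refine hsub.trans (le_of_eq ?_)
          congr 3
          simp only [sub_neg_eq_add, ← two_mul, nnnorm_mul]
          simp [abs_of_nonneg (Real.sqrt_nonneg (L * v ⬝ᵥ v)), hR]
      _ = _ := by
          rw [← Real.exp_add, hR, Real.sq_sqrt (by positivity)]; congr 1; ring
  have hlow : Real.exp (a * (c - M * v ⬝ᵥ v)) ≤ ∫ ω, Real.exp (a * A ω) ∂ν := by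
    set e := Real.exp (a * (c - M * v ⬝ᵥ v)) with he
    calc e = e * (1 - a * c) + e * a * ∫ ω, p ω ⬝ᵥ v ∂ν := by rw [← hc]; ring
      _ = ∫ ω, (e * (1 - a * c) + e * a * p ω ⬝ᵥ v) ∂ν := (integral_const_add_mul hXi _ _).symm
      _ ≤ _ := by
          refine integral_mono_ae ((integrable_const _).add (hXi.const_mul _)) hexp
            (hM.mono fun ω hω => ?_)
          have := Real.add_one_le_exp (a * (p ω ⬝ᵥ v - c))
          calc _ = e * (a * (p ω ⬝ᵥ v - c) + 1) := by ring
            _ ≤ e * Real.exp (a * (p ω ⬝ᵥ v - c)) := by gcongr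
            _ ≤ Real.exp (a * A ω) := by
              rw [he, ← Real.exp_add, ← mul_add]
              gcongr
              linarith [(abs_le.1 hω).1]
  have hpos : 0 < ∫ ω, Real.exp (a * A ω) ∂ν := integral_exp_pos hexp
  have h1 := (Real.le_log_iff_exp_le hpos).2 hlow
  have h2 := (Real.log_le_iff_le_exp hpos).2 hup
  have h3 : 0 ≤ a * L / 2 * v ⬝ᵥ v := by positivity
  rw [← div_eq_inv_mul, abs_le]
  have h1' := (le_div_iff₀' ha).2 h1
  have h2' := (div_le_iff₀' ha).2 h2
  constructor <;> linarith

end Mean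

theorem HasBoundedExpansion.log_integral {N : ℕ} {Ω : Type*} [MeasurableSpace Ω] {μ : Measure Ω}
    [IsProbabilityMeasure μ] {φ : Ω → (Fin N → ℝ) → ℝ} {p : Ω → (Fin N → ℝ) → Fin N → ℝ}
    {L M a : ℝ} (ha : 0 < a) (hφ : Measurable (Function.uncurry φ))
    (hp : Measurable (Function.uncurry p)) (hL : ∀ᵐ ω ∂μ, ∀ x, p ω x ⬝ᵥ p ω x ≤ L)
    (hM : ∀ᵐ ω ∂μ, ∀ x v, |φ ω (x + v) - φ ω x - p ω x ⬝ᵥ v| ≤ M * v ⬝ᵥ v)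
    (hint : ∀ x, Integrable (fun ω => Real.exp (a * φ ω x)) μ) :
    HasBoundedExpansion L (M + a * L / 2)
      (fun x => a⁻¹ * Real.log (∫ ω, Real.exp (a * φ ω x) ∂μ)) := by
  have hpx : ∀ x, Measurable fun ω => p ω x := fun x => hp.comp measurable_prodMk_right
  have hφx : ∀ x, Measurable fun ω => φ ω x := fun x => hφ.comp measurable_prodMk_right
  have hν : ∀ x, IsProbabilityMeasure (μ.tilted fun ω => a * φ ω x) := fun x =>
    isProbabilityMeasure_tilted (hint x)
  have hac : ∀ x, μ.tilted (fun ω => a * φ ω x) ≪ μ := fun x => tilted_absolutelyContinuous _ _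
  refine ⟨fun x i => ∫ ω, p ω x i ∂(μ.tilted fun ω => a * φ ω x), ?_, fun x => ?_, fun x v => ?_⟩
  · refine measurable_pi_lambda _ fun i => ?_
    simp only [integral_tilted, smul_eq_mul]
    have h1 : Measurable fun x => ∫ ω, Real.exp (a * φ ω x) ∂μ := by
      have : Measurable fun q : (Fin N → ℝ) × Ω => Real.exp (a * φ q.2 q.1) :=
        ((hφ.comp measurable_swap).const_mul a).exp
      exact this.stronglyMeasurable.integral_prod_right'.measurable
    have h2 : Measurable fun q : (Fin N → ℝ) × Ω =>
        Real.exp (a * φ q.2 q.1) / (∫ ω, Real.exp (a * φ ω q.1) ∂μ) * p q.2 q.1 i := by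
      refine Measurable.mul (Measurable.div ?_ (h1.comp measurable_fst)) ?_
      · exact ((hφ.comp measurable_swap).const_mul a).exp
      · exact (measurable_pi_apply i).comp (hp.comp measurable_swap)
    exact h2.stronglyMeasurable.integral_prod_right'.measurable
  · have := hν x
    exact mean_dotProduct_self_le (hpx x) ((hac x).ae_le (hL.mono fun ω h => h x))
  · have := hν x
    have h1 := abs_inv_mul_log_integral_exp_sub_le (hpx x)
      ((hac x).ae_le (hL.mono fun ω h => h x)) (A := fun ω => φ ω (x + v) - φ ω x)
      ((hφx _).sub (hφx _)).aestronglyMeasurable ((hac x).ae_le (hM.mono fun ω h => h x v)) ha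
    have h2 : ∫ ω, Real.exp (a * (φ ω (x + v) - φ ω x)) ∂(μ.tilted fun ω => a * φ ω x)
        = (∫ ω, Real.exp (a * φ ω (x + v)) ∂μ) / ∫ ω, Real.exp (a * φ ω x) ∂μ := by
      rw [integral_exp_tilted]
      congr 2 with ω
      simp only [Pi.add_apply]
      ring_nf
    rw [h2, Real.log_div (integral_exp_pos (hint _)).ne' (integral_exp_pos (hint _)).ne',
      mul_sub] at h1
    exact h1

theorem HasBoundedExpansion.parisiStep {N : ℕ} {K : NNReal} {L M a : ℝ} {g : (Fin N → ℝ) → ℝ}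
    (h : HasBoundedExpansion L M g) (hg : LipschitzWith K g) (ha : 0 ≤ a) (s : ℝ) :
    HasBoundedExpansion L (M + a * L / 2) (parisiStep a s g) := by
  obtain ⟨p, hp, hL, hM⟩ := h
  have hgm := hg.continuous.measurable
  rcases ha.eq_or_lt with rfl | ha
  · have hpx : ∀ x, Measurable fun z : Fin N → ℝ => p (x + √(2 * s) • z) := fun x => by fun_prop
    have hLx : ∀ x, ∀ᵐ z ∂(gaussN N), p (x + √(2 * s) • z) ⬝ᵥ p (x + √(2 * s) • z) ≤ L :=
      fun x => ae_of_all _ fun z => hL _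
    refine ⟨fun x i => ∫ z, p (x + √(2 * s) • z) i ∂(gaussN N), ?_, fun x => ?_, fun x v => ?_⟩
    · refine measurable_pi_lambda _ fun i => ?_
      have : Measurable fun q : (Fin N → ℝ) × (Fin N → ℝ) => p (q.1 + √(2 * s) • q.2) i := by
        fun_prop
      exact this.stronglyMeasurable.integral_prod_right'.measurable
    · exact mean_dotProduct_self_le (hpx x) (hLx x)
    · have hi : ∀ y, Integrable (fun z => g (y + √(2 * s) • z)) (gaussN N) := fun y =>
        (hg.comp_add_smul y _).integrable_gaussN
      rw [mean_dotProduct (hpx x) (hLx x)]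
      simp only [_root_.parisiStep, if_true]
      have hdiff : ∫ z, (g (x + v + √(2 * s) • z) - g (x + √(2 * s) • z)
          - p (x + √(2 * s) • z) ⬝ᵥ v) ∂(gaussN N) = ∫ z, g (x + v + √(2 * s) • z) ∂(gaussN N)
            - ∫ z, g (x + √(2 * s) • z) ∂(gaussN N)
            - ∫ z, p (x + √(2 * s) • z) ⬝ᵥ v ∂(gaussN N) := by
        rw [← integral_sub (hi _) (hi _)]
        exact integral_sub ((hi _).sub (hi _)) (integrable_dotProduct_of_le (hpx x) (hLx x) v)
      rw [← hdiff]
      have := norm_integral_le_of_norm_le_const (μ := gaussN N) (C := M * v ⬝ᵥ v)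
        (f := fun z => g (x + v + √(2 * s) • z) - g (x + √(2 * s) • z)
          - p (x + √(2 * s) • z) ⬝ᵥ v) (ae_of_all _ fun z => by
            rw [add_right_comm]; exact hM _ _)
      simpa using this
  · have h1 := HasBoundedExpansion.log_integral (μ := gaussN N) ha
      (φ := fun z x => g (x + √(2 * s) • z)) (p := fun z x => p (x + √(2 * s) • z)) (L := L) (M := M)
      (by unfold Function.uncurry; fun_prop) (by unfold Function.uncurry; fun_prop)
      (ae_of_all _ fun z x => hL _)
      (ae_of_all _ fun z x v => by rw [add_right_comm]; exact hM _ _)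
      (fun x => (hg.comp_add_smul x _).integrable_exp_gaussN a)
    convert h1 using 2 with x
    rw [_root_.parisiStep, if_neg ha.ne']

theorem abs_exp_sub_quadratic_le (t : ℝ) :
    |Real.exp t - (1 + t + t ^ 2 / 2)| ≤ |t| ^ 3 * Real.exp |t| := by
  have h := Complex.norm_exp_sub_sum_le_norm_mul_exp t 3
  have h2 : Complex.exp t - ∑ m ∈ Finset.range 3, (t : ℂ) ^ m / (m.factorial : ℂ)
      = ((Real.exp t - (1 + t + t ^ 2 / 2) : ℝ) : ℂ) := by
    simp [Finset.sum_range_succ]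
  rwa [h2, Complex.norm_real, Complex.norm_real, Real.norm_eq_abs, Real.norm_eq_abs] at h

theorem integrable_sq_of_abs_le {Ω : Type*} [MeasurableSpace Ω] {μ : Measure Ω} {X D : Ω → ℝ}
    {s : ℝ} (hX : AEStronglyMeasurable X μ)
    (hD2 : Integrable (fun ω => D ω ^ 2) μ)
    (hs : 0 ≤ s) (hs1 : s ≤ 1) (hXD : ∀ ω, |X ω| ≤ s * D ω) :
    Integrable (fun ω => X ω ^ 2) μ := by
  refine hD2.mono' (by fun_prop) (ae_of_all _ fun ω => ?_)
  have h0 : 0 ≤ s * D ω := (abs_nonneg _).trans (hXD ω)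
  calc ‖X ω ^ 2‖ = |X ω| ^ 2 := by simp
    _ ≤ (s * D ω) ^ 2 := by gcongr; exact hXD ω
    _ = s ^ 2 * D ω ^ 2 := by ring
    _ ≤ 1 * D ω ^ 2 := by gcongr; exact pow_le_one₀ hs hs1
    _ = _ := one_mul _

section CentredExpansion

variable {Ω : Type*} [MeasurableSpace Ω] {μ : Measure Ω} [IsProbabilityMeasure μ]
  {X D : Ω → ℝ} {s a b : ℝ}

theorem abs_integral_exp_sub_quadratic_le (hXi : Integrable X μ) (hX0 : ∫ ω, X ω ∂μ = 0)
    (hD2 : Integrable (fun ω => D ω ^ 2) μ)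
    (hD3 : Integrable (fun ω => D ω ^ 3 * Real.exp (D ω)) μ)
    (hs : 0 ≤ s) (hs1 : s ≤ 1) (hD0 : ∀ ω, 0 ≤ D ω) (hXD : ∀ ω, |X ω| ≤ s * D ω)
    (hb : 0 ≤ b) (hb1 : b ≤ 1) (he : Integrable (fun ω => Real.exp (b * X ω)) μ) :
    |∫ ω, Real.exp (b * X ω) ∂μ - (1 + b ^ 2 / 2 * ∫ ω, X ω ^ 2 ∂μ)|
      ≤ b ^ 2 * s ^ 3 * ∫ ω, D ω ^ 3 * Real.exp (D ω) ∂μ := by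
  have hX2 := integrable_sq_of_abs_le hXi.aestronglyMeasurable hD2 hs hs1 hXD
  have hi1 : Integrable (fun ω => 1 + b * X ω) μ := (integrable_const _).add (hXi.const_mul b)
  have hi2 : Integrable (fun ω => b ^ 2 / 2 * X ω ^ 2) μ := hX2.const_mul _
  have hi3 : Integrable (fun ω => 1 + b * X ω + b ^ 2 / 2 * X ω ^ 2) μ := hi1.add hi2
  have h1 : ∫ ω, (1 + b * X ω + b ^ 2 / 2 * X ω ^ 2) ∂μ = 1 + b ^ 2 / 2 * ∫ ω, X ω ^ 2 ∂μ := by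
    rw [integral_add hi1 hi2, integral_const_add_mul hXi, hX0, integral_const_mul]
    simp
  rw [← h1, ← integral_sub he hi3, ← integral_const_mul]
  rw [← Real.norm_eq_abs]
  refine norm_integral_le_of_norm_le (hD3.const_mul _) (ae_of_all _ fun ω => ?_)
  have hbX : |b * X ω| ≤ b * s * D ω := by
    rw [abs_mul, abs_of_nonneg hb, mul_assoc]
    gcongr
    exact hXD ω
  have h2 : b * s * D ω ≤ D ω := by
    have := mul_le_one₀ hb1 hs hs1
    exact mul_le_of_le_one_left (hD0 ω) this
  calc _ = |Real.exp (b * X ω) - (1 + b * X ω + (b * X ω) ^ 2 / 2)| := by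
        rw [Real.norm_eq_abs]; ring_nf
    _ ≤ |b * X ω| ^ 3 * Real.exp |b * X ω| := abs_exp_sub_quadratic_le _
    _ ≤ (b * s * D ω) ^ 3 * Real.exp (D ω) := by
        have := hD0 ω
        gcongr
        exact hbX.trans h2
    _ = b * (b ^ 2 * s ^ 3 * (D ω ^ 3 * Real.exp (D ω))) := by ring
    _ ≤ 1 * (b ^ 2 * s ^ 3 * (D ω ^ 3 * Real.exp (D ω))) := by
        have := hD0 ω
        gcongr
    _ = _ := one_mul _

theorem inv_mul_log_integral_exp_le (hXi : Integrable X μ) (hX0 : ∫ ω, X ω ∂μ = 0)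
    (hD2 : Integrable (fun ω => D ω ^ 2) μ)
    (hD3 : Integrable (fun ω => D ω ^ 3 * Real.exp (D ω)) μ)
    (hs : 0 ≤ s) (hs1 : s ≤ 1) (hD0 : ∀ ω, 0 ≤ D ω) (hXD : ∀ ω, |X ω| ≤ s * D ω)
    (hb : 0 < b) (hb1 : b ≤ 1) (he : Integrable (fun ω => Real.exp (b * X ω)) μ) :
    b⁻¹ * Real.log (∫ ω, Real.exp (b * X ω) ∂μ)
      ≤ b / 2 * ∫ ω, X ω ^ 2 ∂μ + s ^ 3 * ∫ ω, D ω ^ 3 * Real.exp (D ω) ∂μ := by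
  have h1 := (abs_le.1 (abs_integral_exp_sub_quadratic_le hXi hX0 hD2 hD3 hs hs1 hD0 hXD
    hb.le hb1 he)).2
  have h2 := Real.log_le_sub_one_of_pos (integral_exp_pos he)
  have hJ : 0 ≤ s ^ 3 * ∫ ω, D ω ^ 3 * Real.exp (D ω) ∂μ :=
    mul_nonneg (by positivity) (integral_nonneg fun ω => by have := hD0 ω; positivity)
  set J := ∫ ω, D ω ^ 3 * Real.exp (D ω) ∂μ
  rw [← div_eq_inv_mul, div_le_iff₀ hb]
  nlinarith [mul_nonneg hJ (mul_nonneg hb.le (sub_nonneg.2 hb1))]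

theorem le_inv_mul_log_integral_exp (hXi : Integrable X μ) (hX0 : ∫ ω, X ω ∂μ = 0)
    (hD2 : Integrable (fun ω => D ω ^ 2) μ)
    (hD3 : Integrable (fun ω => D ω ^ 3 * Real.exp (D ω)) μ)
    (hs : 0 ≤ s) (hs1 : s ≤ 1) (hD0 : ∀ ω, 0 ≤ D ω) (hXD : ∀ ω, |X ω| ≤ s * D ω)
    (ha : 0 < a) (ha1 : a ≤ 1) (he : Integrable (fun ω => Real.exp (a * X ω)) μ) :
    a / 2 * ∫ ω, X ω ^ 2 ∂μ - s ^ 3 * (∫ ω, D ω ^ 3 * Real.exp (D ω) ∂μ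
        + (∫ ω, D ω ^ 2 ∂μ + ∫ ω, D ω ^ 3 * Real.exp (D ω) ∂μ) ^ 2)
      ≤ a⁻¹ * Real.log (∫ ω, Real.exp (a * X ω) ∂μ) := by
  obtain ⟨h1, h2⟩ := abs_le.1 (abs_integral_exp_sub_quadratic_le hXi hX0 hD2 hD3 hs hs1 hD0 hXD
    ha.le ha1 he)
  have hpos := integral_exp_pos he
  have h3 := Real.one_sub_inv_le_log_of_pos hpos
  have hJ : 0 ≤ ∫ ω, D ω ^ 3 * Real.exp (D ω) ∂μ :=
    integral_nonneg fun ω => by have := hD0 ω; positivity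
  have hX2 := integrable_sq_of_abs_le hXi.aestronglyMeasurable hD2 hs hs1 hXD
  have hV : ∫ ω, X ω ^ 2 ∂μ ≤ s ^ 2 * ∫ ω, D ω ^ 2 ∂μ := by
    rw [← integral_const_mul]
    refine integral_mono hX2 (hD2.const_mul _) fun ω => ?_
    simp only [← mul_pow, ← sq_abs (X ω)]
    have := hXD ω
    gcongr
  have hV0 : 0 ≤ ∫ ω, X ω ^ 2 ∂μ := integral_nonneg fun ω => sq_nonneg _
  have hJ2 : 0 ≤ ∫ ω, D ω ^ 2 ∂μ := integral_nonneg fun ω => sq_nonneg _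
  have hI1 : 1 ≤ ∫ ω, Real.exp (a * X ω) ∂μ := by
    calc (1 : ℝ) = ∫ ω, (1 + a * X ω) ∂μ := by rw [integral_const_add_mul hXi, hX0]; simp
      _ ≤ _ := integral_mono ((integrable_const _).add (hXi.const_mul a)) he fun ω => by
          linarith [Real.add_one_le_exp (a * X ω)]
  set J := ∫ ω, D ω ^ 3 * Real.exp (D ω) ∂μ
  set J' := ∫ ω, D ω ^ 2 ∂μ
  set V := ∫ ω, X ω ^ 2 ∂μ
  set I := ∫ ω, Real.exp (a * X ω) ∂μ
  have hu : I - 1 ≤ a ^ 2 * s ^ 2 * (J' + J) := by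
    have hs3 : s ^ 3 * J ≤ s ^ 2 * J := by
      gcongr ?_ * J
      exact pow_le_pow_of_le_one hs hs1 (by norm_num)
    have h4 : V / 2 ≤ s ^ 2 * J' := by linarith
    calc I - 1 ≤ a ^ 2 * (V / 2 + s ^ 3 * J) := by linarith
      _ ≤ a ^ 2 * (s ^ 2 * J' + s ^ 2 * J) := by gcongr
      _ = _ := by ring
  have hu2 : (I - 1) ^ 2 ≤ a ^ 2 * (s ^ 3 * (J' + J) ^ 2) := by
    calc (I - 1) ^ 2 ≤ (a ^ 2 * s ^ 2 * (J' + J)) ^ 2 := by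
          gcongr
      _ = a ^ 2 * (a ^ 2 * (s ^ 4 * (J' + J) ^ 2)) := by ring
      _ ≤ a ^ 2 * (1 * (s ^ 3 * (J' + J) ^ 2)) := by
          gcongr a ^ 2 * (?_ * (?_ * _))
          · exact pow_le_one₀ ha.le ha1
          · exact pow_le_pow_of_le_one hs hs1 (by norm_num)
      _ = _ := by ring
  have h5 : I - 1 - (I - 1) ^ 2 ≤ 1 - I⁻¹ := by
    have : 1 - I⁻¹ - (I - 1 - (I - 1) ^ 2) = (I - 1) ^ 3 / I := by field_simp; ring
    have h6 : 0 ≤ (I - 1) ^ 3 / I := div_nonneg (pow_nonneg (by linarith) 3) hpos.le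
    linarith
  rw [← div_eq_inv_mul, le_div_iff₀ ha]
  have hE : 0 ≤ s ^ 3 * (J + (J' + J) ^ 2) := by positivity
  nlinarith [mul_nonneg hE (mul_nonneg ha.le (sub_nonneg.2 ha1))]

end CentredExpansion

theorem abs_dotProduct_le_sum_abs {N : ℕ} {L : ℝ} {p : Fin N → ℝ} (hp : p ⬝ᵥ p ≤ L)
    (z : Fin N → ℝ) : |p ⬝ᵥ z| ≤ √L * ∑ i, |z i| := by
  rw [dotProduct, Finset.mul_sum]
  refine (Finset.abs_sum_le_sum_abs _ _).trans (Finset.sum_le_sum fun i _ => ?_)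
  rw [abs_mul]
  gcongr
  exact abs_apply_le_sqrt hp i

theorem dotProduct_self_le_sum_abs_sq {N : ℕ} (z : Fin N → ℝ) : z ⬝ᵥ z ≤ (∑ i, |z i|) ^ 2 := by
  refine le_trans (le_of_eq ?_) (Finset.sum_sq_le_sq_sum_of_nonneg fun i _ => abs_nonneg (z i))
  simp [dotProduct, pow_two]

theorem integrable_sum_abs_pow_gaussN (N n : ℕ) :
    Integrable (fun z : Fin N → ℝ => (∑ i, |z i|) ^ n) (gaussN N) := by
  refine integrable_of_exp_gaussN (by fun_prop) (c := n) fun z => ?_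
  have h0 : 0 ≤ ∑ i, |z i| := Finset.sum_nonneg fun _ _ => abs_nonneg _
  rw [abs_of_nonneg (by positivity), Real.exp_nat_mul]
  gcongr
  linarith [Real.add_one_le_exp (∑ i, |z i|)]

theorem integrable_pow_mul_exp_affine_gaussN (N n j : ℕ) {c m : ℝ} (hc : 0 ≤ c) (hm : 0 ≤ m) :
    Integrable (fun z : Fin N → ℝ => (c * (∑ i, |z i| + m)) ^ n
      * Real.exp (j * (c * (∑ i, |z i| + m)))) (gaussN N) := by
  refine ((integrable_exp_sum_abs_gaussN N ((n + j) * c)).const_mul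
    (Real.exp ((n + j) * c * m))).mono' (by fun_prop) (ae_of_all _ fun z => ?_)
  have h0 : 0 ≤ ∑ i, |z i| := Finset.sum_nonneg fun _ _ => abs_nonneg _
  have h1 : 0 ≤ c * (∑ i, |z i| + m) := by positivity
  rw [Real.norm_of_nonneg (by positivity), ← Real.exp_add]
  calc _ ≤ Real.exp (c * (∑ i, |z i| + m)) ^ n * Real.exp (j * (c * (∑ i, |z i| + m))) := by
        gcongr
        linarith [Real.add_one_le_exp (c * (∑ i, |z i| + m))]
    _ = _ := by rw [← Real.exp_nat_mul, ← Real.exp_add]; ring_nf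

theorem LipschitzWith.parisiStep_eq_add {N : ℕ} {K : NNReal} {g : (Fin N → ℝ) → ℝ}
    (hg : LipschitzWith K g) {b : ℝ} (hb : b ≠ 0) (s κ : ℝ) (x : Fin N → ℝ) :
    _root_.parisiStep b s g x
      = κ + b⁻¹ * Real.log (∫ z, Real.exp (b * (g (x + √(2 * s) • z) - κ)) ∂(gaussN N)) := by
  have h1 : ∫ z, Real.exp (b * g (x + √(2 * s) • z)) ∂(gaussN N) = Real.exp (b * κ)
      * ∫ z, Real.exp (b * (g (x + √(2 * s) • z) - κ)) ∂(gaussN N) := by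
    rw [← integral_const_mul]
    congr 1 with z
    rw [← Real.exp_add]
    ring_nf
  have h2 : 0 < ∫ z, Real.exp (b * (g (x + √(2 * s) • z) - κ)) ∂(gaussN N) := by
    have := hg.integral_exp_gaussN_pos b √(2 * s) x
    rw [h1] at this
    exact pos_of_mul_pos_right this (Real.exp_pos _).le
  rw [_root_.parisiStep, if_neg hb, h1, Real.log_mul (Real.exp_pos _).ne' h2.ne', Real.log_exp]
  field_simp

theorem sq_add_le_of_abs_le {A r s l S M : ℝ} (hs : 0 ≤ s) (hs1 : s ≤ 1) (hS : 0 ≤ S)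
    (hl : 0 ≤ l) (hA : |A| ≤ 2 * s * l * S) (hr : |r| ≤ 2 * M * s ^ 2 * S ^ 2) :
    (A + r) ^ 2 ≤ A ^ 2 + s ^ 3 * (8 * M * l * S ^ 3 + 4 * M ^ 2 * S ^ 4) := by
  have h1 : A * r ≤ 2 * s * l * S * (2 * M * s ^ 2 * S ^ 2) :=
    (le_abs_self _).trans (by rw [abs_mul]; gcongr)
  have h2 : r ^ 2 ≤ s ^ 3 * (4 * M ^ 2 * S ^ 4) := by
    calc r ^ 2 = |r| ^ 2 := (sq_abs r).symm
      _ ≤ (2 * M * s ^ 2 * S ^ 2) ^ 2 := by gcongr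
      _ = s ^ 4 * (4 * M ^ 2 * S ^ 4) := by ring
      _ ≤ _ := by
        gcongr ?_ * _
        exact pow_le_pow_of_le_one hs hs1 (by norm_num)
  nlinarith

theorem sqrt_two_mul_sq_le {s : ℝ} (hs : 0 ≤ s) : √(2 * s ^ 2) ≤ 2 * s :=
  Real.sqrt_le_iff.2 ⟨by positivity, by nlinarith [sq_nonneg s]⟩

theorem integral_centred_sq_le {N : ℕ} {K : NNReal} {g : (Fin N → ℝ) → ℝ} {L M s : ℝ}
    (hg : LipschitzWith K g) (h : HasBoundedExpansion L M g) (hM : 0 ≤ M)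
    (hs : 0 ≤ s) (hs1 : s ≤ 1) (x : Fin N → ℝ) :
    ∫ z, (g (x + √(2 * s ^ 2) • z) - ∫ y, g (x + √(2 * s ^ 2) • y) ∂(gaussN N)) ^ 2 ∂(gaussN N)
      ≤ 2 * s ^ 2 * L + s ^ 3 * ∫ z : Fin N → ℝ, (8 * M * √L * (∑ i, |z i|) ^ 3
        + 4 * M ^ 2 * (∑ i, |z i|) ^ 4) ∂(gaussN N) := by
  obtain ⟨p, -, hL, hMx⟩ := h
  have hf := hg.comp_add_smul x √(2 * s ^ 2)
  set c := √(2 * s ^ 2) with hc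
  have hc2 : c ^ 2 = 2 * s ^ 2 := Real.sq_sqrt (by positivity)
  have hcs : c ≤ 2 * s := sqrt_two_mul_sq_le hs
  have hc0 : 0 ≤ c := Real.sqrt_nonneg _
  set κ := ∫ y, g (x + c • y) ∂(gaussN N) with hκ
  have hX0 : ∫ z, (g (x + c • z) - κ) ∂(gaussN N) = 0 := by
    rw [integral_sub hf.integrable_gaussN (integrable_const _)]
    simp [hκ]
  have hXi : Integrable (fun z => g (x + c • z) - κ) (gaussN N) :=
    hf.integrable_gaussN.sub (integrable_const _)
  have hp2 : Integrable (fun z => (p x ⬝ᵥ z) ^ 2) (gaussN N) := by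
    refine ((integrable_sum_abs_pow_gaussN N 2).const_mul (√L ^ 2)).mono'
      (by unfold dotProduct; exact Continuous.aestronglyMeasurable (by fun_prop))
      (ae_of_all _ fun z => ?_)
    rw [← mul_pow, Real.norm_of_nonneg (sq_nonneg _), ← sq_abs]
    gcongr
    exact abs_dotProduct_le_sum_abs (hL x) z
  have hw : Integrable (fun z : Fin N → ℝ => 8 * M * √L * (∑ i, |z i|) ^ 3
      + 4 * M ^ 2 * (∑ i, |z i|) ^ 4) (gaussN N) :=
    ((integrable_sum_abs_pow_gaussN N 3).const_mul _).add
      ((integrable_sum_abs_pow_gaussN N 4).const_mul _)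
  have hi1 := hp2.const_mul (2 * s ^ 2)
  have hi2 := hw.const_mul (s ^ 3)
  have hi3 := hXi.const_mul (2 * (κ - g x))
  have hpt : ∀ z, (g (x + c • z) - κ) ^ 2 ≤ 2 * s ^ 2 * (p x ⬝ᵥ z) ^ 2
      + s ^ 3 * (8 * M * √L * (∑ i, |z i|) ^ 3 + 4 * M ^ 2 * (∑ i, |z i|) ^ 4)
      - 2 * (κ - g x) * (g (x + c • z) - κ) := by
    intro z
    have hS : 0 ≤ ∑ i, |z i| := Finset.sum_nonneg fun _ _ => abs_nonneg _
    have hA : |c * p x ⬝ᵥ z| ≤ 2 * s * √L * ∑ i, |z i| := by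
      rw [abs_mul, abs_of_nonneg hc0, mul_assoc (2 * s)]
      gcongr
      exact abs_dotProduct_le_sum_abs (hL x) z
    have hr : |g (x + c • z) - g x - c * p x ⬝ᵥ z| ≤ 2 * M * s ^ 2 * (∑ i, |z i|) ^ 2 := by
      have h1 := hMx x (c • z)
      simp only [dotProduct_smul, smul_dotProduct, smul_eq_mul] at h1
      refine h1.trans ?_
      have h2 : M * (c * (c * z ⬝ᵥ z)) = 2 * M * s ^ 2 * z ⬝ᵥ z := by
        linear_combination (M * z ⬝ᵥ z) * hc2
      rw [h2]
      gcongr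
      exact dotProduct_self_le_sum_abs_sq z
    have h3 := sq_add_le_of_abs_le hs hs1 hS (Real.sqrt_nonneg L) hA hr
    rw [mul_pow, hc2] at h3
    nlinarith [sq_nonneg (κ - g x)]
  have hsum : Integrable (fun z => 2 * s ^ 2 * (p x ⬝ᵥ z) ^ 2
      + s ^ 3 * (8 * M * √L * (∑ i, |z i|) ^ 3 + 4 * M ^ 2 * (∑ i, |z i|) ^ 4)) (gaussN N) :=
    hi1.add hi2
  calc _ ≤ ∫ z, (2 * s ^ 2 * (p x ⬝ᵥ z) ^ 2
      + s ^ 3 * (8 * M * √L * (∑ i, |z i|) ^ 3 + 4 * M ^ 2 * (∑ i, |z i|) ^ 4)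
      - 2 * (κ - g x) * (g (x + c • z) - κ)) ∂(gaussN N) :=
        integral_mono_of_nonneg (ae_of_all _ fun z => sq_nonneg _) (hsum.sub hi3)
          (ae_of_all _ hpt)
    _ = 2 * s ^ 2 * p x ⬝ᵥ p x + s ^ 3 * ∫ z : Fin N → ℝ, (8 * M * √L * (∑ i, |z i|) ^ 3
        + 4 * M ^ 2 * (∑ i, |z i|) ^ 4) ∂(gaussN N) := by
      rw [integral_sub hsum hi3, integral_add hi1 hi2, integral_const_mul, integral_const_mul,
        integral_const_mul, hX0, integral_dotProduct_sq_gaussN, mul_zero, sub_zero]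
    _ ≤ _ := by
      gcongr
      exact hL x

theorem LipschitzWith.abs_sub_integral_le {N : ℕ} {K : NNReal} {g : (Fin N → ℝ) → ℝ} {s : ℝ}
    (hg : LipschitzWith K g) (hs : 0 ≤ s) (x z : Fin N → ℝ) :
    |g (x + √(2 * s ^ 2) • z) - ∫ y, g (x + √(2 * s ^ 2) • y) ∂(gaussN N)|
      ≤ s * (2 * K * (∑ i, |z i| + ∫ y : Fin N → ℝ, ∑ i, |y i| ∂(gaussN N))) := by
  have hf := (hg.comp_add_smul x √(2 * s ^ 2)).integrable_gaussN
  have hpt : ∀ y, |g (x + √(2 * s ^ 2) • y) - g x| ≤ s * (2 * K) * ∑ i, |y i| := by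
    intro y
    refine (hg.abs_add_sub_le x _).trans ?_
    rw [norm_smul, Real.norm_of_nonneg (Real.sqrt_nonneg _)]
    calc _ ≤ K * (2 * s * ∑ i, |y i|) := by
          gcongr
          · exact sqrt_two_mul_sq_le hs
          · exact norm_le_sum_abs y
      _ = _ := by ring
  have h1 : |∫ y, g (x + √(2 * s ^ 2) • y) ∂(gaussN N) - g x|
      ≤ s * (2 * K) * ∫ y : Fin N → ℝ, ∑ i, |y i| ∂(gaussN N) := by
    have h2 : ∫ y, g (x + √(2 * s ^ 2) • y) ∂(gaussN N) - g x
        = ∫ y, (g (x + √(2 * s ^ 2) • y) - g x) ∂(gaussN N) := by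
      rw [integral_sub hf (integrable_const _)]
      simp
    rw [h2, ← integral_const_mul, ← Real.norm_eq_abs]
    refine norm_integral_le_of_norm_le (Integrable.const_mul ?_ _) (ae_of_all _ hpt)
    simpa using integrable_sum_abs_pow_gaussN N 1
  have h3 := abs_sub_le (g (x + √(2 * s ^ 2) • z)) (g x)
    (∫ y, g (x + √(2 * s ^ 2) • y) ∂(gaussN N))
  rw [abs_sub_comm (g x)] at h3
  linarith [hpt z]

theorem exists_parisiStep_le_add (N : ℕ) (K : NNReal) {L M : ℝ} (hM : 0 ≤ M) :
    ∃ C, ∀ g : (Fin N → ℝ) → ℝ, LipschitzWith K g → HasBoundedExpansion L M g →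
      ∀ a b s, 0 ≤ a → a ≤ b → b ≤ 1 → 0 ≤ s → s ≤ 1 → ∀ x,
        parisiStep b (s ^ 2) g x ≤ parisiStep a (s ^ 2) g x + (b - a) * s ^ 2 * L + C * s ^ 3 := by
  set m := ∫ y : Fin N → ℝ, ∑ i, |y i| ∂(gaussN N) with hm
  have hS : ∀ z : Fin N → ℝ, 0 ≤ ∑ i, |z i| := fun z => Finset.sum_nonneg fun _ _ => abs_nonneg _
  have hm0 : 0 ≤ m := integral_nonneg hS
  set D : (Fin N → ℝ) → ℝ := fun z => 2 * K * (∑ i, |z i| + m) with hD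
  have hD0 : ∀ z, 0 ≤ D z := fun z => by have := hS z; simp only [hD]; positivity
  have hD2 : Integrable (fun z => D z ^ 2) (gaussN N) := by
    simpa using integrable_pow_mul_exp_affine_gaussN N 2 0 (c := 2 * K) (by positivity) hm0
  have hD3 : Integrable (fun z => D z ^ 3 * Real.exp (D z)) (gaussN N) := by
    simpa using integrable_pow_mul_exp_affine_gaussN N 3 1 (c := 2 * K) (by positivity) hm0
  set J := ∫ z, D z ^ 3 * Real.exp (D z) ∂(gaussN N)
  set J' := ∫ z, D z ^ 2 ∂(gaussN N)
  set W := ∫ z : Fin N → ℝ, (8 * M * √L * (∑ i, |z i|) ^ 3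
    + 4 * M ^ 2 * (∑ i, |z i|) ^ 4) ∂(gaussN N) with hW
  have hJ : 0 ≤ J := integral_nonneg fun z => by have := hD0 z; positivity
  have hW0 : 0 ≤ W := integral_nonneg fun z => by have := hS z; positivity
  refine ⟨W + 2 * J + (J' + J) ^ 2, fun g hg h a b s ha hab hb1 hs hs1 x => ?_⟩
  set κ := ∫ y, g (x + √(2 * s ^ 2) • y) ∂(gaussN N) with hκ
  have hfi := (hg.comp_add_smul x √(2 * s ^ 2)).integrable_gaussN
  have hX0 : ∫ z, (g (x + √(2 * s ^ 2) • z) - κ) ∂(gaussN N) = 0 := by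
    rw [integral_sub hfi (integrable_const _)]
    simp [hκ]
  have hXi : Integrable (fun z => g (x + √(2 * s ^ 2) • z) - κ) (gaussN N) :=
    hfi.sub (integrable_const _)
  have hXD : ∀ z, |g (x + √(2 * s ^ 2) • z) - κ| ≤ s * D z := hg.abs_sub_integral_le hs x
  have he : ∀ t,
      Integrable (fun z => Real.exp (t * (g (x + √(2 * s ^ 2) • z) - κ))) (gaussN N) := by
    intro t
    refine (((hg.comp_add_smul x √(2 * s ^ 2)).integrable_exp_gaussN t).mul_const
      (Real.exp (-(t * κ)))).congr (ae_of_all _ fun z => ?_)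
    simp only [← Real.exp_add]
    ring_nf
  have hV := integral_centred_sq_le hg h hM hs hs1 x
  rw [← hκ, ← hW] at hV
  set V := ∫ z, (g (x + √(2 * s ^ 2) • z) - κ) ^ 2 ∂(gaussN N)
  have hba : (b - a) / 2 * V ≤ (b - a) * s ^ 2 * L + s ^ 3 * W := by
    have h1 := mul_le_mul_of_nonneg_left hV (a := (b - a) / 2) (by linarith)
    have h2 : 0 ≤ (1 - (b - a) / 2) * (s ^ 3 * W) := mul_nonneg (by linarith) (by positivity)
    linarith
  rcases (ha.trans hab).eq_or_lt with hb0 | hb0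
  · obtain rfl : a = 0 := le_antisymm (hb0 ▸ hab) ha
    subst hb0
    have : 0 ≤ (W + 2 * J + (J' + J) ^ 2) * s ^ 3 := by positivity
    linarith
  have hup := inv_mul_log_integral_exp_le hXi hX0 hD2 hD3 hs hs1 hD0 hXD hb0 hb1 (he b)
  rw [hg.parisiStep_eq_add hb0.ne' _ κ]
  have hnn : 0 ≤ s ^ 3 * (J' + J) ^ 2 := by positivity
  have hnn' : 0 ≤ s ^ 3 * J := by positivity
  rcases ha.eq_or_lt with rfl | ha0
  · have : parisiStep 0 (s ^ 2) g x = κ := by rw [parisiStep, if_pos rfl]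
    rw [this]
    linarith
  · have hlow := le_inv_mul_log_integral_exp hXi hX0 hD2 hD3 hs hs1 hD0 hXD ha0
      (hab.trans hb1) (he a)
    rw [hg.parisiStep_eq_add ha0.ne' _ κ]
    linarith

theorem HasBoundedExpansion.mono {N : ℕ} {L M M' : ℝ} {g : (Fin N → ℝ) → ℝ}
    (h : HasBoundedExpansion L M g) (hM : M ≤ M') : HasBoundedExpansion L M' g := by
  obtain ⟨p, hp, hL, hx⟩ := h
  refine ⟨p, hp, hL, fun x v => (hx x v).trans ?_⟩
  have : 0 ≤ v ⬝ᵥ v := Finset.sum_nonneg fun i _ => mul_self_nonneg _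
  gcongr

/-- Raising the exponent from `a` to `b` costs at most `(b - a) δ L`, where `L` bounds the squared
gradient of `g`. -/
theorem parisiStep_le_add_mul {N : ℕ} {K : NNReal} {L M a b δ : ℝ} {g : (Fin N → ℝ) → ℝ}
    (hg : LipschitzWith K g) (h : HasBoundedExpansion L M g) (hL : 0 ≤ L) (hM : 0 ≤ M)
    (ha : 0 ≤ a) (hab : a ≤ b) (hb1 : b ≤ 1) (hδ : 0 ≤ δ) (x : Fin N → ℝ) :
    parisiStep b δ g x ≤ parisiStep a δ g x + (b - a) * δ * L := by
  obtain ⟨C, hC⟩ := exists_parisiStep_le_add N K (L := L) (M := M + L / 2) (by positivity)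
  have hb : 0 ≤ b := ha.trans hab
  have hexp : ∀ t, HasBoundedExpansion L (M + L / 2) (parisiStep a t g) := fun t =>
    (h.parisiStep hg ha t).mono (by nlinarith)
  have hiter : ∀ s, 0 ≤ s → s ≤ 1 → ∀ (j : ℕ) x, parisiStep b (j * s ^ 2) g x
      ≤ parisiStep a (j * s ^ 2) g x + j * ((b - a) * s ^ 2 * L + C * s ^ 3) := by
    intro s hs hs1 j
    induction j with
    | zero => intro x; simp [parisiStep_zero_right]
    | succ j ih =>
      intro x
      have hj : 0 ≤ (j : ℝ) * s ^ 2 := by positivity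
      have e : ((j + 1 : ℕ) : ℝ) * s ^ 2 = s ^ 2 + j * s ^ 2 := by push_cast; ring
      rw [e, ← parisiStep_parisiStep hg ha (sq_nonneg s) hj,
        ← parisiStep_parisiStep hg hb (sq_nonneg s) hj]
      have h1 := parisiStep_le_add (hg.parisiStep hb _) (hg.parisiStep ha _) hb (s ^ 2) ih x
      have h2 := hC _ (hg.parisiStep ha (j * s ^ 2)) (hexp _) a b s ha hab hb1 hs hs1 x
      push_cast
      linarith
  have hlim : Filter.Tendsto (fun n : ℕ => parisiStep a δ g x + (b - a) * δ * L
      + C * δ * √(δ / n)) Filter.atTop (nhds (parisiStep a δ g x + (b - a) * δ * L)) := by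
    have h1 : Filter.Tendsto (fun n : ℕ => √(δ / n)) Filter.atTop (nhds √0) :=
      (tendsto_const_div_atTop_nhds_zero_nat δ).sqrt
    rw [Real.sqrt_zero] at h1
    simpa using (h1.const_mul (C * δ)).const_add (parisiStep a δ g x + (b - a) * δ * L)
  refine ge_of_tendsto hlim ?_
  filter_upwards [Filter.eventually_ge_atTop (max 1 ⌈δ⌉₊)] with n hn
  have hn1 : (1 : ℝ) ≤ n := by exact_mod_cast (le_max_left _ _).trans hn
  have hnδ : δ ≤ n := Nat.ceil_le.1 ((le_max_right _ _).trans hn)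
  have hn0 : (n : ℝ) ≠ 0 := by positivity
  have hs2 : √(δ / n) ^ 2 = δ / n := Real.sq_sqrt (by positivity)
  have hs1 : √(δ / n) ≤ 1 := Real.sqrt_le_one.2 (div_le_one_of_le₀ hnδ (by positivity))
  have h1 := hiter √(δ / n) (Real.sqrt_nonneg _) hs1 n x
  rw [pow_succ _ 2, hs2, mul_div_cancel₀ _ hn0] at h1
  have e : (n : ℝ) * ((b - a) * (δ / n) * L + C * (δ / n * √(δ / n)))
      = (b - a) * δ * L + C * δ * √(δ / n) := by field_simp
  rw [e] at h1
  linarith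

/-- `log ∫ exp (G(σ) + x · σ - c |σ|²) dP(σ)`. -/
noncomputable def logPartition {N : ℕ} (c : ℝ) (P : Measure (Fin N → ℝ)) (G : (Fin N → ℝ) → ℝ)
    (x : Fin N → ℝ) : ℝ :=
  Real.log (∫ σ, Real.exp (G σ + x ⬝ᵥ σ - c * σ ⬝ᵥ σ) ∂P)

section LogPartition

variable {N : ℕ} {P : Measure (Fin N → ℝ)} [IsProbabilityMeasure P] {G : (Fin N → ℝ) → ℝ}
  {B R c : ℝ}

theorem abs_dotProduct_le_sqrt_mul_norm {σ : Fin N → ℝ} (h : σ ⬝ᵥ σ ≤ R) (v : Fin N → ℝ) :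
    |v ⬝ᵥ σ| ≤ √R * N * ‖v‖ := by
  rw [dotProduct_comm, mul_assoc]
  refine (abs_dotProduct_le_sum_abs h v).trans ?_
  gcongr
  simpa using Finset.sum_le_sum fun i (_ : i ∈ Finset.univ) => norm_le_pi_norm v i

theorem exp_potential_le {σ : Fin N → ℝ} (hG : ∀ σ, |G σ| ≤ B) (h : σ ⬝ᵥ σ ≤ R) (hc : 0 ≤ c)
    (x : Fin N → ℝ) :
    Real.exp (G σ + x ⬝ᵥ σ - c * σ ⬝ᵥ σ) ≤ Real.exp (B + √R * ∑ i, |x i|) := by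
  have h1 := (abs_le.1 (hG σ)).2
  have h2 := (abs_le.1 (abs_dotProduct_le_sum_abs h x)).2
  rw [dotProduct_comm] at h2
  have h3 : 0 ≤ c * σ ⬝ᵥ σ := mul_nonneg hc (Finset.sum_nonneg fun i _ => mul_self_nonneg _)
  gcongr
  linarith

theorem integrable_exp_potential (hGm : Measurable G) (hG : ∀ σ, |G σ| ≤ B)
    (hR : ∀ᵐ σ ∂P, σ ⬝ᵥ σ ≤ R) (hc : 0 ≤ c) (x : Fin N → ℝ) :
    Integrable (fun σ => Real.exp (G σ + x ⬝ᵥ σ - c * σ ⬝ᵥ σ)) P := by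
  refine Integrable.of_bound (C := Real.exp (B + √R * ∑ i, |x i|)) ?_ ?_
  · unfold dotProduct
    exact Measurable.aestronglyMeasurable (by fun_prop)
  · filter_upwards [hR] with σ h
    rw [Real.norm_of_nonneg (Real.exp_pos _).le]
    exact exp_potential_le hG h hc x

theorem exists_lipschitzWith_logPartition (hGm : Measurable G) (hG : ∀ σ, |G σ| ≤ B)
    (hR : ∀ᵐ σ ∂P, σ ⬝ᵥ σ ≤ R) (hc : 0 ≤ c) :
    ∃ K, LipschitzWith K (logPartition c P G) := by
  refine ⟨NNReal.sqrt R.toNNReal * N, LipschitzWith.of_le_add_mul _ fun x y => ?_⟩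
  have hi := integrable_exp_potential hGm hG hR hc
  have h1 : ∫ σ, Real.exp (G σ + x ⬝ᵥ σ - c * σ ⬝ᵥ σ) ∂P
      ≤ Real.exp (√R * N * ‖x - y‖) * ∫ σ, Real.exp (G σ + y ⬝ᵥ σ - c * σ ⬝ᵥ σ) ∂P := by
    rw [← integral_const_mul]
    refine integral_mono_ae (hi x) ((hi y).const_mul _) ?_
    filter_upwards [hR] with σ h
    have h2 := (abs_le.1 (abs_dotProduct_le_sqrt_mul_norm h (x - y))).2
    rw [sub_dotProduct] at h2
    simp only [← Real.exp_add]
    gcongr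
    linarith
  have h3 := Real.log_le_log (integral_exp_pos (hi x)) h1
  rw [Real.log_mul (Real.exp_pos _).ne' (integral_exp_pos (hi y)).ne', Real.log_exp] at h3
  rw [logPartition, logPartition, add_comm, dist_eq_norm]
  have h4 : ((NNReal.sqrt R.toNNReal * N : NNReal) : ℝ) = √R * N := by
    rw [NNReal.coe_mul, NNReal.coe_natCast, Real.sqrt]
  rwa [h4]

theorem hasBoundedExpansion_logPartition (hGm : Measurable G) (hG : ∀ σ, |G σ| ≤ B)
    (hR : ∀ᵐ σ ∂P, σ ⬝ᵥ σ ≤ R) (hc : 0 ≤ c) :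
    HasBoundedExpansion R (R / 2) (logPartition c P G) := by
  have h := HasBoundedExpansion.log_integral (μ := P) (a := 1) (L := R) (M := 0) one_pos
    (φ := fun σ x => G σ + x ⬝ᵥ σ - c * σ ⬝ᵥ σ) (p := fun σ _ => σ)
    (by unfold Function.uncurry dotProduct; fun_prop) (by unfold Function.uncurry; fun_prop)
    (hR.mono fun σ h _ => h) (ae_of_all _ fun σ x v => by
      rw [add_dotProduct, dotProduct_comm σ v]
      ring_nf
      simp)
    (fun x => by simpa only [one_mul] using integrable_exp_potential hGm hG hR hc x)
  unfold logPartition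
  simpa using h

theorem parisiStep_one_logPartition (hGm : Measurable G) (hG : ∀ σ, |G σ| ≤ B)
    (hR : ∀ᵐ σ ∂P, σ ⬝ᵥ σ ≤ R) (hc : 0 ≤ c) {δ : ℝ} (hδ : 0 ≤ δ) :
    parisiStep 1 δ (logPartition (c + δ) P G) = logPartition c P G := by
  ext x
  have hcδ : 0 ≤ c + δ := add_nonneg hc hδ
  have hint : Integrable (Function.uncurry fun z σ : Fin N → ℝ =>
      Real.exp (G σ + (x + √(2 * δ) • z) ⬝ᵥ σ - (c + δ) * σ ⬝ᵥ σ)) ((gaussN N).prod P) := by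
    have h1 : Integrable (fun z : Fin N → ℝ => Real.exp (B + √R * ∑ i, |x i|)
        * Real.exp (√R * √(2 * δ) * ∑ i, |z i|)) (gaussN N) :=
      (integrable_exp_sum_abs_gaussN N _).const_mul _
    refine (h1.comp_fst P).mono' ?_ ?_
    · unfold Function.uncurry dotProduct
      exact Measurable.aestronglyMeasurable (by fun_prop)
    · filter_upwards [Measure.quasiMeasurePreserving_snd.ae hR] with ω h
      rw [Function.uncurry, Real.norm_of_nonneg (Real.exp_pos _).le]
      refine (exp_potential_le hG h hcδ _).trans ?_
      rw [← Real.exp_add]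
      have h2 : ∑ i, |(x + √(2 * δ) • ω.1) i| ≤ ∑ i, |x i| + √(2 * δ) * ∑ i, |ω.1 i| := by
        rw [Finset.mul_sum, ← Finset.sum_add_distrib]
        refine Finset.sum_le_sum fun i _ => (abs_add_le _ _).trans ?_
        simp [abs_mul, abs_of_nonneg (Real.sqrt_nonneg _)]
      have h3 := mul_le_mul_of_nonneg_left h2 (Real.sqrt_nonneg R)
      refine Real.exp_le_exp.2 ?_
      linarith
  have hkey : ∫ z, Real.exp (logPartition (c + δ) P G (x + √(2 * δ) • z)) ∂(gaussN N)
      = ∫ σ, Real.exp (G σ + x ⬝ᵥ σ - c * σ ⬝ᵥ σ) ∂P := by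
    have h1 : ∀ z, Real.exp (logPartition (c + δ) P G (x + √(2 * δ) • z))
        = ∫ σ, Real.exp (G σ + (x + √(2 * δ) • z) ⬝ᵥ σ - (c + δ) * σ ⬝ᵥ σ) ∂P := fun z =>
      Real.exp_log (integral_exp_pos (integrable_exp_potential hGm hG hR hcδ _))
    simp only [h1]
    rw [integral_integral_swap hint]
    congr 1 with σ
    have h2 : ∀ z, Real.exp (G σ + (x + √(2 * δ) • z) ⬝ᵥ σ - (c + δ) * σ ⬝ᵥ σ)
        = Real.exp (G σ + x ⬝ᵥ σ - (c + δ) * σ ⬝ᵥ σ) * Real.exp (√(2 * δ) * z ⬝ᵥ σ) := fun z => by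
      rw [← Real.exp_add, add_dotProduct, smul_dotProduct, smul_eq_mul]
      ring_nf
    simp only [h2]
    rw [integral_const_mul, integral_exp_dotProduct_gaussN, ← Real.exp_add,
      Real.sq_sqrt (by positivity)]
    ring_nf
  simp only [parisiStep, one_ne_zero, if_false, inv_one, one_mul, hkey]
  rfl

end LogPartition

theorem abs_parisiStep_sub_le {N : ℕ} {K K' : NNReal} {U V : (Fin N → ℝ) → ℝ}
    {L M a b d d' e δ S : ℝ} (hU : LipschitzWith K U) (hV : LipschitzWith K' V)
    (hVe : HasBoundedExpansion L M V) (hL : 0 ≤ L) (hM : 0 ≤ M) (ha : 0 ≤ a) (hab : a ≤ b)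
    (hb1 : b ≤ 1) (hd : 0 ≤ d) (hd' : 0 ≤ d') (he : 0 ≤ e) (hδ : 0 ≤ δ) (hsum : e + d' = d + δ)
    (h : ∀ x, |U x - parisiStep b δ V x| ≤ S) (x : Fin N → ℝ) :
    |parisiStep a d U x - parisiStep a e (parisiStep a d' V) x| ≤ (b - a) * δ * L + S := by
  rw [parisiStep_parisiStep hV ha he hd', hsum, ← parisiStep_parisiStep hV ha hd hδ]
  have hA := hV.parisiStep ha δ
  have h1 := parisiStep_le_add hU hA ha d (c := (b - a) * δ * L + S) (fun y => by
    linarith [(abs_le.1 (h y)).2, parisiStep_le_add_mul hV hVe hL hM ha hab hb1 hδ y]) x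
  have h2 := parisiStep_le_add hA hU ha d (c := S) (fun y => by
    linarith [(abs_le.1 (h y)).1, parisiStep_mono_left hV ha hab δ y]) x
  have h3 : 0 ≤ (b - a) * δ * L := mul_nonneg (mul_nonneg (sub_nonneg.2 hab) hδ) hL
  exact abs_le.2 ⟨by linarith, by linarith⟩

/-- The increment `q_ℓ - q_{ℓ-1}`, with the convention `q_{-1} = 0`. -/
def parisiIncrement (q : ℕ → ℝ) (ℓ : ℕ) : ℝ :=
  q ℓ - if ℓ = 0 then 0 else q (ℓ - 1)

/-- The cascade as a sequence of functions of the total external field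
`∑_ℓ (2q_ℓ - 2q_{ℓ-1})^{1/2} y_ℓ`. -/
noncomputable def fieldCascade {N : ℕ} (k : ℕ) (ζ q : ℕ → ℝ) (P : Measure (Fin N → ℝ))
    (G : (Fin N → ℝ) → ℝ) : ℕ → (Fin N → ℝ) → ℝ
  | 0 => logPartition (q k) P G
  | j + 1 => parisiStep (ζ (k - j)) (parisiIncrement q (k - j)) (fieldCascade k ζ q P G j)

section Cascade

variable {N k : ℕ} {ζ q q' : ℕ → ℝ} {P : Measure (Fin N → ℝ)} {G : (Fin N → ℝ) → ℝ}

theorem Xtop_eq_logPartition (y : ℕ → Fin N → ℝ) :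
    Xtop N k q P G y = logPartition (q k) P G
      (∑ ℓ ∈ Finset.range (k + 1), √(2 * parisiIncrement q ℓ) • y ℓ) := by
  rw [Xtop, logPartition]
  congr 2 with σ
  simp only [sum_dotProduct, smul_dotProduct, smul_eq_mul, parisiIncrement, mul_sub]
  simp [dotProduct, pow_two]

theorem cascade_eq_fieldCascade (hζ : ∀ ℓ, 1 ≤ ℓ → ℓ ≤ k → ζ ℓ ≠ 0) {j : ℕ} (hj : j ≤ k)
    (y : ℕ → Fin N → ℝ) :
    cascade N k ζ q P G j y = fieldCascade k ζ q P G j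
      (∑ ℓ ∈ Finset.range (k + 1 - j), √(2 * parisiIncrement q ℓ) • y ℓ) := by
  induction j generalizing y with
  | zero => exact Xtop_eq_logPartition y
  | succ j ih =>
    have e1 : k + 1 - j = k - j + 1 := by omega
    have e2 : k + 1 - (j + 1) = k - j := by omega
    rw [cascade, fieldCascade, parisiStep, if_neg (hζ _ (by omega) (by omega)), e2]
    refine congrArg (fun f => (ζ (k - j))⁻¹ *
      Real.log (∫ z, Real.exp (ζ (k - j) * f z) ∂(gaussN N))) (funext fun z => ?_)
    rw [ih (by omega), e1, Finset.sum_range_succ, Function.update_self]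
    congr 2
    refine Finset.sum_congr rfl fun ℓ hℓ => ?_
    rw [Function.update_of_ne (Finset.mem_range.1 hℓ).ne]

theorem freeEnergyQ_eq_fieldCascade (hζ0 : ζ 0 = 0) (hζ : ∀ ℓ, 1 ≤ ℓ → ℓ ≤ k → ζ ℓ ≠ 0) :
    freeEnergyQ N k ζ P G q = -(1 / (N : ℝ)) * fieldCascade k ζ q P G (k + 1) 0 := by
  rw [freeEnergyQ, fieldCascade, Nat.sub_self, hζ0, parisiStep, if_pos rfl]
  simp [cascade_eq_fieldCascade hζ le_rfl]

theorem parisiIncrement_nonneg (hq0 : 0 ≤ q 0) (hq : ∀ ℓ < k, q ℓ ≤ q (ℓ + 1)) {ℓ : ℕ}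
    (hℓ : ℓ ≤ k) : 0 ≤ parisiIncrement q ℓ := by
  cases ℓ with
  | zero => simpa [parisiIncrement] using hq0
  | succ ℓ => simpa [parisiIncrement] using hq ℓ hℓ

theorem nonneg_of_le_succ (hq0 : 0 ≤ q 0) (hq : ∀ ℓ < k, q ℓ ≤ q (ℓ + 1)) {ℓ : ℕ}
    (hℓ : ℓ ≤ k) : 0 ≤ q ℓ := by
  induction ℓ with
  | zero => exact hq0
  | succ ℓ ih => exact (ih (by omega)).trans (hq ℓ hℓ)

variable [IsProbabilityMeasure P] {B R : ℝ}

theorem exists_regularity_fieldCascade (hGm : Measurable G) (hG : ∀ σ, |G σ| ≤ B)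
    (hR : ∀ᵐ σ ∂P, σ ⬝ᵥ σ ≤ R) (hR0 : 0 ≤ R) (hζ : ∀ ℓ ≤ k, 0 ≤ ζ ℓ) (hqk : 0 ≤ q k) (j : ℕ) :
    ∃ K M, LipschitzWith K (fieldCascade k ζ q P G j) ∧ 0 ≤ M ∧
      HasBoundedExpansion R M (fieldCascade k ζ q P G j) := by
  induction j with
  | zero =>
    obtain ⟨K, hK⟩ := exists_lipschitzWith_logPartition hGm hG hR hqk
    exact ⟨K, R / 2, hK, by positivity, hasBoundedExpansion_logPartition hGm hG hR hqk⟩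
  | succ j ih =>
    obtain ⟨K, M, hK, hM, h⟩ := ih
    have h0 := hζ (k - j) (Nat.sub_le _ _)
    exact ⟨K, _, hK.parisiStep h0 _, by positivity, h.parisiStep hK h0 _⟩

theorem abs_fieldCascade_sub_le (hGm : Measurable G) (hG : ∀ σ, |G σ| ≤ B)
    (hR : ∀ᵐ σ ∂P, σ ⬝ᵥ σ ≤ R) (hR0 : 0 ≤ R) (hζ0 : 0 ≤ ζ 0) (hζtop : ζ (k + 1) = 1)
    (hζ : ∀ ℓ < k + 1, ζ ℓ ≤ ζ (ℓ + 1)) (hq0 : 0 ≤ q 0) (hq : ∀ ℓ < k, q ℓ ≤ q (ℓ + 1))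
    (hq'0 : 0 ≤ q' 0) (hq' : ∀ ℓ < k, q' ℓ ≤ q' (ℓ + 1)) (hqq' : ∀ ℓ ≤ k, q ℓ ≤ q' ℓ) :
    |fieldCascade k ζ q P G (k + 1) 0 - fieldCascade k ζ q' P G (k + 1) 0|
      ≤ R * ∑ ℓ ∈ Finset.range (k + 1), (ζ (ℓ + 1) - ζ ℓ) * (q' ℓ - q ℓ) := by
  have hζnn : ∀ ℓ ≤ k + 1, 0 ≤ ζ ℓ := fun ℓ => nonneg_of_le_succ hζ0 hζ
  have hζ1 : ∀ ℓ ≤ k + 1, ζ ℓ ≤ 1 := fun ℓ hℓ => by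
    refine Nat.decreasingInduction' (P := fun ℓ => ζ ℓ ≤ 1) (fun i hi _ h => (hζ i hi).trans h)
      hℓ hζtop.le
  have hreg := exists_regularity_fieldCascade (q := q) hGm hG hR hR0 (fun ℓ h => hζnn ℓ (by omega))
    (nonneg_of_le_succ hq0 hq le_rfl)
  have hreg' := exists_regularity_fieldCascade (q := q') hGm hG hR hR0
    (fun ℓ h => hζnn ℓ (by omega)) (nonneg_of_le_succ hq'0 hq' le_rfl)
  have hstep : ∀ (n j : ℕ) (e S : ℝ), n + j = k → 0 ≤ e →
      e + parisiIncrement q' n = parisiIncrement q n + (q' n - q n) →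
      (∀ x, |fieldCascade k ζ q P G j x
        - parisiStep (ζ (n + 1)) (q' n - q n) (fieldCascade k ζ q' P G j) x| ≤ S) →
      ∀ x, |fieldCascade k ζ q P G (j + 1) x
        - parisiStep (ζ n) e (fieldCascade k ζ q' P G (j + 1)) x|
          ≤ (ζ (n + 1) - ζ n) * (q' n - q n) * R + S := by
    intro n j e S hn he hsum h x
    obtain ⟨K, M, hK, -, -⟩ := hreg j
    obtain ⟨K', M', hK', hM', hexp⟩ := hreg' j
    rw [fieldCascade, fieldCascade, show k - j = n by omega]
    exact abs_parisiStep_sub_le hK hK' hexp hR0 hM' (hζnn n (by omega)) (hζ n (by omega))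
      (hζ1 _ (by omega)) (parisiIncrement_nonneg hq0 hq (by omega))
      (parisiIncrement_nonneg hq'0 hq' (by omega)) he (sub_nonneg.2 (hqq' n (by omega))) hsum h x
  have hmain : ∀ (j n : ℕ), n + j = k → ∀ x, |fieldCascade k ζ q P G j x
      - parisiStep (ζ (n + 1)) (q' n - q n) (fieldCascade k ζ q' P G j) x|
        ≤ R * ∑ ℓ ∈ Finset.Ico (n + 1) (k + 1), (ζ (ℓ + 1) - ζ ℓ) * (q' ℓ - q ℓ) := by
    intro j
    induction j with
    | zero =>
      intro n hn x
      obtain rfl : n = k := hn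
      have h := parisiStep_one_logPartition hGm hG hR (nonneg_of_le_succ hq0 hq le_rfl)
        (sub_nonneg.2 (hqq' n le_rfl))
      rw [add_sub_cancel] at h
      simp [fieldCascade, hζtop, h]
    | succ j ih =>
      intro n hn x
      refine (hstep (n + 1) j (q' n - q n) _ (by omega) (sub_nonneg.2 (hqq' n (by omega)))
        (by simp [parisiIncrement]) (ih (n + 1) (by omega)) x).trans (le_of_eq ?_)
      rw [Finset.sum_eq_sum_Ico_succ_bot (show n + 1 < k + 1 by omega)]
      ring
  have h := hstep 0 k 0 _ (by omega) le_rfl (by simp [parisiIncrement]) (hmain k 0 (by omega)) 0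
  rw [parisiStep_zero_right] at h
  refine h.trans (le_of_eq ?_)
  rw [Finset.range_eq_Ico, Finset.sum_eq_sum_Ico_succ_bot (show 0 < k + 1 by omega)]
  ring

theorem abs_freeEnergyQ_sub_le_of_le (hN : 1 ≤ N) (hζ0 : ζ 0 = 0) (hζtop : ζ (k + 1) = 1)
    (hζ : ∀ ℓ ≤ k, ζ ℓ < ζ (ℓ + 1)) (hq0 : 0 < q 0) (hq : ∀ ℓ < k, q ℓ < q (ℓ + 1))
    (hq'0 : 0 < q' 0) (hq' : ∀ ℓ < k, q' ℓ < q' (ℓ + 1)) (hqq' : ∀ ℓ ≤ k, q ℓ ≤ q' ℓ)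
    (hP : P {σ | ∑ i, σ i ^ 2 ≤ N} = 1) (hGm : Measurable G) (hG : ∀ σ, |G σ| ≤ B) :
    |freeEnergyQ N k ζ P G q' - freeEnergyQ N k ζ P G q|
      ≤ ∑ ℓ ∈ Finset.range (k + 1), (ζ (ℓ + 1) - ζ ℓ) * (q' ℓ - q ℓ) := by
  have hζ' : ∀ ℓ < k + 1, ζ ℓ ≤ ζ (ℓ + 1) := fun ℓ h => (hζ ℓ (by omega)).le
  have hζne : ∀ ℓ, 1 ≤ ℓ → ℓ ≤ k → ζ ℓ ≠ 0 := by
    intro ℓ h1 h2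
    obtain ⟨ℓ, rfl⟩ := Nat.exists_eq_add_of_le' h1
    exact ((nonneg_of_le_succ hζ0.ge hζ' (by omega)).trans_lt (hζ ℓ (by omega))).ne'
  have hR : ∀ᵐ σ ∂P, σ ⬝ᵥ σ ≤ (N : ℝ) := by
    have hm : MeasurableSet {σ : Fin N → ℝ | ∑ i, σ i ^ 2 ≤ N} :=
      measurableSet_le (by fun_prop) measurable_const
    filter_upwards [(mem_ae_iff_prob_eq_one hm).2 hP] with σ h
    simpa [dotProduct, pow_two] using h
  have h := abs_fieldCascade_sub_le hGm hG hR (Nat.cast_nonneg N) hζ0.ge hζtop hζ' hq0.le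
    (fun ℓ h => (hq ℓ h).le) hq'0.le (fun ℓ h => (hq' ℓ h).le) hqq'
  have hN0 : (0 : ℝ) < N := by exact_mod_cast hN
  rw [freeEnergyQ_eq_fieldCascade hζ0 hζne, freeEnergyQ_eq_fieldCascade hζ0 hζne, ← mul_sub,
    abs_mul, abs_neg, abs_of_pos (by positivity), abs_sub_comm, one_div, inv_mul_le_iff₀ hN0]
  exact h

end Cascade

/-- Proposition 2.1 of the paper (conditionally on the disorder): for `P` supported in
`{|σ|² ≤ N}`, `|F(q') - F(q)| ≤ ∑_ℓ (ζ_{ℓ+1} - ζ_ℓ) |q'_ℓ - q_ℓ|`. -/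
theorem freeEnergyQ_lipschitz (N k : ℕ) (hN : 1 ≤ N)
    (ζ : ℕ → ℝ) (hζ0 : ζ 0 = 0) (hζtop : ζ (k + 1) = 1)
    (hζ : ∀ ℓ ≤ k, ζ ℓ < ζ (ℓ + 1))
    (q q' : ℕ → ℝ) (hq0 : 0 < q 0) (hq : ∀ ℓ < k, q ℓ < q (ℓ + 1))
    (hq'0 : 0 < q' 0) (hq' : ∀ ℓ < k, q' ℓ < q' (ℓ + 1))
    (P : Measure (Fin N → ℝ)) [IsProbabilityMeasure P]
    (hP : P {σ | ∑ i, σ i ^ 2 ≤ N} = 1)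
    (G : (Fin N → ℝ) → ℝ) (hGmeas : Measurable G) (hGbdd : ∃ C, ∀ σ, |G σ| ≤ C) :
    |freeEnergyQ N k ζ P G q' - freeEnergyQ N k ζ P G q|
      ≤ ∑ ℓ ∈ Finset.range (k + 1), (ζ (ℓ + 1) - ζ ℓ) * |q' ℓ - q ℓ| := by
  obtain ⟨B, hG⟩ := hGbdd
  set r : ℕ → ℝ := fun ℓ => max (q ℓ) (q' ℓ) with hr
  have hr0 : 0 < r 0 := lt_max_of_lt_left hq0
  have hrs : ∀ ℓ < k, r ℓ < r (ℓ + 1) := fun ℓ h => max_lt_max (hq ℓ h) (hq' ℓ h)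
  have h1 := abs_freeEnergyQ_sub_le_of_le hN hζ0 hζtop hζ hq0 hq hr0 hrs
    (fun ℓ _ => le_max_left _ _) hP hGmeas hG
  have h2 := abs_freeEnergyQ_sub_le_of_le hN hζ0 hζtop hζ hq'0 hq' hr0 hrs
    (fun ℓ _ => le_max_right _ _) hP hGmeas hG
  rw [abs_sub_comm] at h2
  refine (abs_sub_le _ (freeEnergyQ N k ζ P G r) _).trans ((add_le_add h2 h1).trans (le_of_eq ?_))
  rw [← Finset.sum_add_distrib]
  refine Finset.sum_congr rfl fun ℓ _ => ?_
  rw [← mul_add]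
  congr 1
  simp only [hr]
  rcases le_total (q ℓ) (q' ℓ) with h | h
  · rw [max_eq_right h, abs_of_nonneg (sub_nonneg.2 h)]
    ring
  · rw [max_eq_left h, abs_of_nonpos (sub_nonpos.2 h)]
    ring
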